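/- arXiv:2006.16435 — 7 statements merged into one kernel-verified Lean document; each statement's English description precedes it below -/
import Mathlib

section
/- An almost contact structure (φ, ξ, η) on a finite-dimensional real Lie algebra 𝔤 is normal if and only if both of the following hold: (1) [ξ, φ(x)] = φ([ξ, x]) for all x ∈ 𝔤, and (2) [φ(X), φ(Y)] − [X, Y] = φ([φ(X), Y] + [X, φ(Y)]) for all X, Y ∈ ker η. -/
/-- In an almost contact structure, `φ` kills the Reeb vector `ξ`. -/
theorem almostContact_apply_reeb {V : Type*} [AddCommGroup V] [Module ℝ V]
    {φ : V →ₗ[ℝ] V} {ξ : V} {η : V →ₗ[ℝ] ℝ}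
    (hφ : ∀ x : V, φ (φ x) = -x + η x • ξ) (hη : η ξ = 1) : φ ξ = 0 := by
  have hsq : φ (φ ξ) = 0 := by simp [hφ, hη]
  have hξ : φ ξ = η (φ ξ) • ξ := by
    have h := hφ (φ ξ)
    rw [hsq, map_zero] at h
    exact neg_add_eq_zero.mp h.symm
  have hc : η (φ ξ) = 0 := by
    have h : η (φ (φ ξ)) = η (φ ξ) * η (φ ξ) := by
      conv_lhs => rw [hξ]
      simp
    rw [hsq, map_zero] at h
    exact mul_self_eq_zero.mp h.symm
  rw [hξ, hc, zero_smul]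

/-- In an almost contact structure, `φ` takes values in `ker η`. -/
theorem almostContact_eta_apply {V : Type*} [AddCommGroup V] [Module ℝ V]
    {φ : V →ₗ[ℝ] V} {ξ : V} {η : V →ₗ[ℝ] ℝ}
    (hφ : ∀ x : V, φ (φ x) = -x + η x • ξ) (hη : η ξ = 1) (x : V) : η (φ x) = 0 := by
  have h := hφ (φ x)
  rw [hφ x, map_add, map_neg, map_smul, almostContact_apply_reeb hφ hη, smul_zero] at h
  simpa [hη] using congrArg η h

/-- An almost contact structure `(φ, ξ, η)` on a finite-dimensional real Lie
algebra `𝔤` is normal if and only if (1) `[ξ, φ x] = φ [ξ, x]` for all `x`, and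
(2) `[φ X, φ Y] − [X, Y] = φ ([φ X, Y] + [X, φ Y])` for all `X, Y ∈ ker η`. -/
theorem normality_characterization
    {L : Type*} [LieRing L] [LieAlgebra ℝ L] [FiniteDimensional ℝ L]
    (φ : L →ₗ[ℝ] L) (ξ : L) (η : L →ₗ[ℝ] ℝ)
    (hφ : ∀ x : L, φ (φ x) = -x + η x • ξ) (hη : η ξ = 1) :
    (∀ X Y : L,
        ⁅φ X, φ Y⁆ + φ (φ ⁅X, Y⁆) - φ ⁅φ X, Y⁆ - φ ⁅X, φ Y⁆ - η ⁅X, Y⁆ • ξ = 0)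
      ↔ ((∀ x : L, ⁅ξ, φ x⁆ = φ ⁅ξ, x⁆) ∧
          (∀ X Y : L, η X = 0 → η Y = 0 →
            ⁅φ X, φ Y⁆ - ⁅X, Y⁆ = φ (⁅φ X, Y⁆ + ⁅X, φ Y⁆))) := by
  have hξ := almostContact_apply_reeb hφ hη
  have hηφ := almostContact_eta_apply hφ hη
  have key : ∀ X Y : L,
      ⁅φ X, φ Y⁆ + φ (φ ⁅X, Y⁆) - φ ⁅φ X, Y⁆ - φ ⁅X, φ Y⁆ - η ⁅X, Y⁆ • ξ
        = ⁅φ X, φ Y⁆ - ⁅X, Y⁆ - φ (⁅φ X, Y⁆ + ⁅X, φ Y⁆) := by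
    intro X Y
    rw [hφ, map_add]
    abel
  simp only [key, sub_eq_zero]
  constructor
  · intro h
    refine ⟨fun x => ?_, fun X Y _ _ => h X Y⟩
    have hbr : ∀ Y, ⁅ξ, Y⁆ = -φ ⁅ξ, φ Y⁆ := by
      intro Y
      have hY := h ξ Y
      rw [hξ, zero_lie, zero_lie, zero_sub, zero_add] at hY
      rw [← hY, neg_neg]
    have hη0 : η ⁅ξ, φ x⁆ = 0 := by rw [hbr (φ x), map_neg, hηφ, neg_zero]
    rw [hbr x, map_neg, hφ, hη0, zero_smul, add_zero, neg_neg]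
  · rintro ⟨h₁, h₂⟩ X Y
    have hbr : ∀ Z, φ ⁅ξ, φ Z⁆ = -⁅ξ, Z⁆ := by
      intro Z
      rw [← h₁, hφ, lie_add, lie_neg, lie_smul, lie_self, smul_zero, add_zero]
    have hbr' : ∀ Z, φ ⁅φ Z, ξ⁆ = -⁅Z, ξ⁆ := by
      intro Z
      rw [← lie_skew, map_neg, hbr, lie_skew Z ξ]
    have h := h₂ (X - η X • ξ) (Y - η Y • ξ) (by simp [hη]) (by simp [hη])
    simp only [map_sub, map_add, map_smul, hξ, smul_zero, sub_zero, lie_sub, sub_lie, lie_smul,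
      smul_lie, lie_self, hbr, hbr'] at h
    rw [map_add, ← sub_eq_zero]
    rw [← sub_eq_zero] at h
    rw [← h]
    module
end

section
/- Let (φ, ξ, η) be an abelian almost contact structure on a finite-dimensional real Lie algebra 𝔤 such that ξ lies in the center of 𝔤. Then 𝔤 is 2-step solvable, i.e. [[𝔤, 𝔤], [𝔤, 𝔤]] = 0. -/
open scoped TensorProduct

/-- Lie algebra analogue of Itô's theorem: a Lie algebra that is the sum of two abelian
subspaces is metabelian. -/
theorem lie_lie_lie_eq_zero_of_sup_eq_top {R M : Type*} [CommRing R] [LieRing M] [LieAlgebra R M]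
    {A B : Submodule R M} (hA : ∀ x ∈ A, ∀ y ∈ A, ⁅x, y⁆ = 0) (hB : ∀ x ∈ B, ∀ y ∈ B, ⁅x, y⁆ = 0)
    (hAB : A ⊔ B = ⊤) (s t u v : M) : ⁅(⁅s, t⁆ : M), (⁅u, v⁆ : M)⁆ = 0 := by
  have split (x : M) : ∃ a ∈ A, ∃ b ∈ B, a + b = x :=
    Submodule.mem_sup.1 (hAB ▸ Submodule.mem_top)
  have mixed {a b a' b' : M} (ha : a ∈ A) (hb : b ∈ B) (ha' : a' ∈ A) (hb' : b' ∈ B) :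
      ⁅(⁅a, b⁆ : M), (⁅a', b'⁆ : M)⁆ = 0 := by
    obtain ⟨x, hx, y, hy, hxy⟩ := split ⁅a, b'⁆
    obtain ⟨z, hz, w, hw, hzw⟩ := split ⁅a', b⁆
    have h₁ : ⁅(⁅a, b⁆ : M), a'⁆ = -⁅a, w⁆ := by
      rw [lie_lie, hA a ha a' ha', lie_zero, sub_zero, ← lie_skew b a', ← hzw, lie_neg, lie_add,
        hA a ha z hz, zero_add]
    have h₂ : ⁅(⁅a, w⁆ : M), b'⁆ = ⁅x, w⁆ := by
      rw [lie_lie, hB w hw b' hb', lie_zero, zero_sub, ← hxy, lie_add, hB w hw y hy, add_zero,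
        lie_skew]
    have h₃ : ⁅(⁅a, b⁆ : M), b'⁆ = ⁅x, b⁆ := by
      rw [lie_lie, hB b hb b' hb', lie_zero, zero_sub, ← hxy, lie_add, hB b hb y hy, add_zero,
        lie_skew]
    have h₄ : ⁅a', (⁅x, b⁆ : M)⁆ = ⁅x, w⁆ := by
      rw [leibniz_lie, hA a' ha' x hx, zero_lie, zero_add, ← hzw, lie_add, hA x hx z hz, zero_add]
    rw [leibniz_lie, h₁, neg_lie, h₂, h₃, h₄, neg_add_cancel]
  obtain ⟨a, ha, b, hb, rfl⟩ := split s
  obtain ⟨a', ha', b', hb', rfl⟩ := split t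
  obtain ⟨c, hc, d, hd, rfl⟩ := split u
  obtain ⟨c', hc', d', hd', rfl⟩ := split v
  have h₁ : ⁅a + b, a' + b'⁆ = ⁅a, b'⁆ - ⁅a', b⁆ := by
    rw [lie_add, add_lie, add_lie, hA a ha a' ha', hB b hb b' hb', ← lie_skew b a']
    abel
  have h₂ : ⁅c + d, c' + d'⁆ = ⁅c, d'⁆ - ⁅c', d⁆ := by
    rw [lie_add, add_lie, add_lie, hA c hc c' hc', hB d hd d' hd', ← lie_skew d c']
    abel
  rw [h₁, h₂, lie_sub, sub_lie, sub_lie, mixed ha hb' hc hd', mixed ha' hb hc hd',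
    mixed ha hb' hc' hd, mixed ha' hb hc' hd]
  simp

/-- The bracket vanishes on the span of a set of pairwise commuting elements. -/
theorem lie_eq_zero_of_mem_span {R M : Type*} [CommRing R] [LieRing M] [LieAlgebra R M]
    {S : Set M} (hS : ∀ x ∈ S, ∀ y ∈ S, ⁅x, y⁆ = 0) :
    ∀ x ∈ Submodule.span R S, ∀ y ∈ Submodule.span R S, ⁅x, y⁆ = 0 := by
  intro x hx y hy
  induction hx, hy using Submodule.span_induction₂ with
  | mem_mem x y hx hy => exact hS x hx y hy
  | zero_left y hy => exact zero_lie y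
  | zero_right x hx => exact lie_zero x
  | add_left x y z _ _ _ h₁ h₂ => rw [add_lie, h₁, h₂, add_zero]
  | add_right x y z _ _ _ h₁ h₂ => rw [lie_add, h₁, h₂, add_zero]
  | smul_left r x y _ _ h => rw [smul_lie, h, smul_zero]
  | smul_right r x y _ _ h => rw [lie_smul, h, smul_zero]

/-- In an almost contact structure, `η ∘ φ = 0`. -/
theorem almostContact_eta_phi {L : Type*} [AddCommGroup L] [Module ℝ L]
    {φ : L →ₗ[ℝ] L} {ξ : L} {η : L →ₗ[ℝ] ℝ}
    (hφ : ∀ x : L, φ (φ x) = -x + η x • ξ) (hη : η ξ = 1) (x : L) : η (φ x) = 0 := by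
  have hcube (y : L) : η y • φ ξ = η (φ y) • ξ := by
    have h := hφ (φ y)
    rw [hφ y, map_add, map_neg, map_smul] at h
    exact add_left_cancel h
  have hξ : φ ξ = η (φ ξ) • ξ := by simpa [hη] using hcube ξ
  have hsq : η (φ ξ) * η (φ ξ) = 0 := by
    have h : φ (φ ξ) = 0 := by rw [hφ, hη, one_smul, neg_add_cancel]
    rw [hξ, map_smul] at h
    simpa using congrArg η h
  have hφξ : φ ξ = 0 := by rw [hξ, mul_self_eq_zero.1 hsq, zero_smul]
  simpa [hφξ, hη] using (congrArg η (hcube x)).symm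

/-- If `(φ, ξ, η)` is an abelian almost contact structure on a
finite-dimensional real Lie algebra `𝔤` with `ξ` central, then `𝔤` is 2-step solvable,
i.e. `[[𝔤,𝔤],[𝔤,𝔤]] = 0`. -/
theorem abelian_central_xi_two_step_solvable
    {L : Type*} [LieRing L] [LieAlgebra ℝ L] [FiniteDimensional ℝ L]
    (φ : L →ₗ[ℝ] L) (ξ : L) (η : L →ₗ[ℝ] ℝ)
    (hφ : ∀ x : L, φ (φ x) = -x + η x • ξ) (hη : η ξ = 1)
    (hab₁ : ∀ x : L, ⁅ξ, φ x⁆ = φ ⁅ξ, x⁆)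
    (hab₂ : ∀ X Y : L, η X = 0 → η Y = 0 → ⁅φ X, φ Y⁆ = ⁅X, Y⁆)
    (hcentral : ∀ x : L, ⁅ξ, x⁆ = 0) :
    ∀ a b c d : L, ⁅(⁅a, b⁆ : L), (⁅c, d⁆ : L)⁆ = 0 := by
  intro a b c d
  have hskew (X Y : L) (hX : η X = 0) (hY : η Y = 0) : ⁅φ X, Y⁆ = -⁅X, φ Y⁆ := by
    rw [← hab₂ X (φ Y) hX (almostContact_eta_phi hφ hη Y), hφ, hY, zero_smul, add_zero, lie_neg,
      neg_neg]
  have hcomm (z : ℂ) (hz : z * z = -1) (X Y : L) (hX : η X = 0) (hY : η Y = 0) :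
      ⁅(1 : ℂ) ⊗ₜ[ℝ] X + z ⊗ₜ[ℝ] φ X, (1 : ℂ) ⊗ₜ[ℝ] Y + z ⊗ₜ[ℝ] φ Y⁆ = 0 := by
    simp only [lie_add, add_lie, LieAlgebra.ExtendScalars.bracket_tmul, hz, hab₂ X Y hX hY,
      hskew X Y hX hY, one_mul, mul_one, TensorProduct.neg_tmul, TensorProduct.tmul_neg]
    abel
  have hξ_left (Y : L) : ⁅(1 : ℂ) ⊗ₜ[ℝ] ξ, (1 : ℂ) ⊗ₜ[ℝ] Y + Complex.I ⊗ₜ[ℝ] φ Y⁆ = 0 := by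
    refine (lie_add ((1 : ℂ) ⊗ₜ[ℝ] ξ) ((1 : ℂ) ⊗ₜ[ℝ] Y) (Complex.I ⊗ₜ[ℝ] φ Y)).trans ?_
    simp only [LieAlgebra.ExtendScalars.bracket_tmul, hcentral, TensorProduct.tmul_zero,
      add_zero]
  have hξ_right (X : L) : ⁅(1 : ℂ) ⊗ₜ[ℝ] X + Complex.I ⊗ₜ[ℝ] φ X, (1 : ℂ) ⊗ₜ[ℝ] ξ⁆ = 0 := by
    rw [← lie_skew, hξ_left, neg_zero]
  -- The eigenspaces of the complexified `φ` on `ker η`, the second one enlarged by `ξ`.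
  let S : Set (ℂ ⊗[ℝ] L) := {w | ∃ X, η X = 0 ∧ (1 : ℂ) ⊗ₜ[ℝ] X + (-Complex.I) ⊗ₜ[ℝ] φ X = w}
  let T : Set (ℂ ⊗[ℝ] L) := insert ((1 : ℂ) ⊗ₜ[ℝ] ξ)
    {w | ∃ X, η X = 0 ∧ (1 : ℂ) ⊗ₜ[ℝ] X + Complex.I ⊗ₜ[ℝ] φ X = w}
  have hS : ∀ x ∈ S, ∀ y ∈ S, ⁅x, y⁆ = 0 := by
    rintro _ ⟨X, hX, rfl⟩ _ ⟨Y, hY, rfl⟩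
    exact hcomm _ (by simp) X Y hX hY
  have hT : ∀ x ∈ T, ∀ y ∈ T, ⁅x, y⁆ = 0 := by
    rintro _ (rfl | ⟨X, hX, rfl⟩) _ (rfl | ⟨Y, hY, rfl⟩)
    · exact lie_self _
    · exact hξ_left Y
    · exact hξ_right X
    · exact hcomm _ (by simp) X Y hX hY
  have htop : Submodule.span ℂ S ⊔ Submodule.span ℂ T = ⊤ := by
    rw [eq_top_iff, ← Submodule.span_union]
    have hker (X : L) (hX : η X = 0) : (1 : ℂ) ⊗ₜ[ℝ] X ∈ Submodule.span ℂ (S ∪ T) := by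
      have h : (1 : ℂ) ⊗ₜ[ℝ] X = (1 / 2 : ℂ) • (((1 : ℂ) ⊗ₜ[ℝ] X + (-Complex.I) ⊗ₜ[ℝ] φ X) +
          ((1 : ℂ) ⊗ₜ[ℝ] X + Complex.I ⊗ₜ[ℝ] φ X)) := by
        rw [TensorProduct.neg_tmul]
        module
      rw [h]
      exact Submodule.smul_mem _ _ (add_mem (Submodule.subset_span (.inl ⟨X, hX, rfl⟩))
        (Submodule.subset_span (.inr (.inr ⟨X, hX, rfl⟩))))
    have hone (x : L) : (1 : ℂ) ⊗ₜ[ℝ] x ∈ Submodule.span ℂ (S ∪ T) := by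
      have h : (1 : ℂ) ⊗ₜ[ℝ] x =
          (1 : ℂ) ⊗ₜ[ℝ] (x - η x • ξ) + (η x : ℂ) • ((1 : ℂ) ⊗ₜ[ℝ] ξ) := by
        rw [Complex.coe_smul, TensorProduct.tmul_sub, TensorProduct.tmul_smul]
        exact (sub_add_cancel _ _).symm
      rw [h]
      exact add_mem (hker _ (by simp [hη]))
        (Submodule.smul_mem _ _ (Submodule.subset_span (.inr (.inl rfl))))
    rintro w -
    induction w using TensorProduct.induction_on with
    | zero => exact zero_mem _
    | tmul z x => simpa [TensorProduct.smul_tmul'] using Submodule.smul_mem _ z (hone x)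
    | add x y hx hy => exact add_mem hx hy
  have hzero := lie_lie_lie_eq_zero_of_sup_eq_top (lie_eq_zero_of_mem_span hS)
    (lie_eq_zero_of_mem_span hT) htop ((1 : ℂ) ⊗ₜ[ℝ] a) ((1 : ℂ) ⊗ₜ[ℝ] b) ((1 : ℂ) ⊗ₜ[ℝ] c)
    ((1 : ℂ) ⊗ₜ[ℝ] d)
  simp only [LieAlgebra.ExtendScalars.bracket_tmul, mul_one] at hzero
  refine Module.FaithfullyFlat.tensorProduct_mk_injective (A := ℝ) (B := ℂ) L ?_
  simpa using hzero
end

section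
/- Let J be an abelian complex structure on a finite-dimensional real Lie algebra 𝔥 and let σ be a J-invariant 2-cocycle on 𝔥. Then σ(x, y) = 0 whenever x and y lie in the commutator ideal [𝔥, 𝔥]; in particular σ([a,b], [c,d]) = 0 for all a, b, c, d ∈ 𝔥. -/
open scoped TensorProduct

/-- A form of Itô's theorem on sums of two abelian subalgebras: a 2-cocycle for which two spanning
abelian subalgebras are isotropic vanishes on pairs of mixed brackets. -/
theorem cocycle_lie_lie_eq_zero_of_codisjoint {R M : Type*} [CommRing R] [LieRing M]
    [LieAlgebra R M] (σ : M →ₗ[R] M →ₗ[R] R) (A B : Submodule R M) (hAB : A ⊔ B = ⊤)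
    (hA : ∀ a ∈ A, ∀ a' ∈ A, ⁅a, a'⁆ = 0) (hB : ∀ b ∈ B, ∀ b' ∈ B, ⁅b, b'⁆ = 0)
    (hσA : ∀ a ∈ A, ∀ a' ∈ A, σ a a' = 0) (hσB : ∀ b ∈ B, ∀ b' ∈ B, σ b b' = 0)
    (hskew : ∀ x y, σ x y = -σ y x)
    (hcocycle : ∀ x y z, σ ⁅x, y⁆ z + σ ⁅y, z⁆ x + σ ⁅z, x⁆ y = 0)
    {a a' b b' : M} (ha : a ∈ A) (ha' : a' ∈ A) (hb : b ∈ B) (hb' : b' ∈ B) :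
    σ ⁅a, b⁆ ⁅a', b'⁆ = 0 := by
  have dec (x : M) : ∃ u ∈ A, ∃ v ∈ B, u + v = x :=
    Submodule.mem_sup.mp (hAB ▸ Submodule.mem_top)
  have cyc (x y z : M) : σ ⁅x, y⁆ z = σ x ⁅y, z⁆ - σ y ⁅x, z⁆ := by
    have h := hcocycle x y z
    rw [hskew ⁅y, z⁆, hskew ⁅z, x⁆, ← lie_skew z x, map_neg] at h
    linear_combination h
  obtain ⟨u, hu, v, hv, huv⟩ := dec ⁅b, a'⁆
  obtain ⟨p, hp, q, hq, hpq⟩ := dec ⁅a, b'⁆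
  have h₁ : ⁅b, ⁅a', b'⁆⁆ = ⁅u, b'⁆ := by
    rw [leibniz_lie, hB b hb b' hb', ← huv, add_lie, hB v hv b' hb']; simp
  have h₂ : ⁅a, ⁅a', b'⁆⁆ = ⁅a', q⁆ := by
    rw [leibniz_lie, hA a ha a' ha', ← hpq, lie_add, hA a' ha' p hp]; simp
  have h₃ : σ a ⁅u, b'⁆ = σ u q := by
    have h := cyc a u b'
    rw [hA a ha u hu, ← hpq, map_add, hσA u hu p hp] at h
    simp only [map_zero, LinearMap.zero_apply] at h
    linear_combination -h
  have h₄ : σ b ⁅a', q⁆ = σ u q := by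
    have h := cyc b a' q
    rw [hB b hb q hq, ← huv, map_add, LinearMap.add_apply, hσB v hv q hq] at h
    simp only [map_zero] at h
    linear_combination -h
  rw [cyc, h₁, h₂, h₃, h₄, sub_self]

/-- The complex form of the vanishing theorem. -/
theorem cocycle_lie_lie_eq_zero_of_complex {M : Type*} [LieRing M] [LieAlgebra ℂ M]
    (J : M →ₗ[ℂ] M) (hJ2 : ∀ x, J (J x) = -x) (hJab : ∀ x y, ⁅J x, J y⁆ = ⁅x, y⁆)
    (σ : M →ₗ[ℂ] M →ₗ[ℂ] ℂ) (hskew : ∀ x y, σ x y = -σ y x)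
    (hcocycle : ∀ x y z, σ ⁅x, y⁆ z + σ ⁅y, z⁆ x + σ ⁅z, x⁆ y = 0)
    (hJinv : ∀ x y, σ (J x) (J y) = σ x y) (a b c d : M) : σ ⁅a, b⁆ ⁅c, d⁆ = 0 := by
  let E (μ : ℂ) : Submodule ℂ M := Module.End.eigenspace J μ
  have mem {μ : ℂ} {x : M} : x ∈ E μ ↔ J x = μ • x := Module.End.mem_eigenspace_iff
  have dec (x : M) : ∃ u ∈ E Complex.I, ∃ v ∈ E (-Complex.I), u + v = x := by
    refine ⟨(2⁻¹ : ℂ) • (x - Complex.I • J x), ?_, (2⁻¹ : ℂ) • (x + Complex.I • J x), ?_, ?_⟩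
    · rw [mem]
      simp only [map_smul, map_sub, hJ2, smul_sub, smul_smul, smul_neg]
      linear_combination (norm := module) ((2⁻¹ : ℂ) * Complex.I_mul_I) • J x
    · rw [mem]
      simp only [map_smul, map_add, hJ2, smul_add, smul_smul, smul_neg]
      linear_combination (norm := module) ((2⁻¹ : ℂ) * Complex.I_mul_I) • J x
    · module
  have hI {μ : ℂ} (hμ : μ * μ = -1) : (∀ x ∈ E μ, ∀ y ∈ E μ, ⁅x, y⁆ = 0) ∧
      (∀ x ∈ E μ, ∀ y ∈ E μ, σ x y = 0) := by
    refine ⟨fun x hx y hy ↦ ?_, fun x hx y hy ↦ ?_⟩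
    · have h := hJab x y
      rw [mem.mp hx, mem.mp hy, smul_lie, lie_smul, smul_smul, hμ, neg_one_smul] at h
      have : (2 : ℂ) • ⁅x, y⁆ = 0 := by
        rw [two_smul]; nth_rewrite 1 [← h]; exact neg_add_cancel _
      simpa using this
    · have h := hJinv x y
      rw [mem.mp hx, mem.mp hy] at h
      simp only [map_smul, LinearMap.smul_apply, smul_eq_mul] at h
      linear_combination -(1 / 2) * h + (1 / 2) * σ x y * hμ
  obtain ⟨hA, hσA⟩ := hI (μ := Complex.I) Complex.I_mul_I
  obtain ⟨hB, hσB⟩ := hI (μ := -Complex.I) (by simp)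
  have key {p q r s : M} (hp : p ∈ E Complex.I) (hq : q ∈ E (-Complex.I))
      (hr : r ∈ E Complex.I) (hs : s ∈ E (-Complex.I)) : σ ⁅p, q⁆ ⁅r, s⁆ = 0 :=
    cocycle_lie_lie_eq_zero_of_codisjoint σ _ _
      (eq_top_iff.mpr fun x _ ↦ Submodule.mem_sup.mpr (dec x))
      hA hB hσA hσB hskew hcocycle hp hr hq hs
  have lie_dec {p q r s : M} (hp : p ∈ E Complex.I) (hq : q ∈ E (-Complex.I))
      (hr : r ∈ E Complex.I) (hs : s ∈ E (-Complex.I)) :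
      ⁅p + q, r + s⁆ = ⁅p, s⁆ - ⁅r, q⁆ := by
    rw [add_lie, lie_add, lie_add, hA p hp r hr, hB q hq s hs, ← lie_skew q r]
    abel
  obtain ⟨a₁, ha₁, a₂, ha₂, rfl⟩ := dec a
  obtain ⟨b₁, hb₁, b₂, hb₂, rfl⟩ := dec b
  obtain ⟨c₁, hc₁, c₂, hc₂, rfl⟩ := dec c
  obtain ⟨d₁, hd₁, d₂, hd₂, rfl⟩ := dec d
  rw [lie_dec ha₁ ha₂ hb₁ hb₂, lie_dec hc₁ hc₂ hd₁ hd₂]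
  simp only [map_sub, LinearMap.sub_apply]
  rw [key ha₁ hb₂ hc₁ hd₂, key ha₁ hb₂ hd₁ hc₂, key hb₁ ha₂ hc₁ hd₂, key hb₁ ha₂ hd₁ hc₂]
  simp

theorem cocycle_lie_lie_eq_zero {L : Type*} [LieRing L] [LieAlgebra ℝ L]
    (J : L →ₗ[ℝ] L) (hJ2 : ∀ x, J (J x) = -x) (hJab : ∀ x y, ⁅J x, J y⁆ = ⁅x, y⁆)
    (σ : L →ₗ[ℝ] L →ₗ[ℝ] ℝ) (halt : ∀ x, σ x x = 0)
    (hcocycle : ∀ x y z, σ ⁅x, y⁆ z + σ ⁅y, z⁆ x + σ ⁅z, x⁆ y = 0)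
    (hJinv : ∀ x y, σ (J x) (J y) = σ x y) (a b c d : L) : σ ⁅a, b⁆ ⁅c, d⁆ = 0 := by
  let τ : LinearMap.BilinForm ℂ (ℂ ⊗[ℝ] L) := LinearMap.BilinForm.baseChange ℂ σ
  have τ_tmul (s t : ℂ) (x y : L) : τ (s ⊗ₜ x) (t ⊗ₜ y) = s * t * (σ x y : ℝ) := by
    simp [τ, LinearMap.BilinForm.baseChange_tmul, mul_comm]
  have skew (x y : L) : σ x y = -σ y x := (LinearMap.IsAlt.neg halt y x).symm
  have h := cocycle_lie_lie_eq_zero_of_complex (M := ℂ ⊗[ℝ] L) (J.baseChange ℂ)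
    (fun x ↦ by
      induction x with
      | zero => simp
      | tmul s x => simp [hJ2, TensorProduct.tmul_neg]
      | add x y hx hy => rw [map_add, map_add, hx, hy, neg_add])
    (fun x y ↦ by
      induction x with
      | zero => simp
      | add x x' hx hx' => rw [map_add, add_lie, add_lie, hx, hx']
      | tmul s x =>
        induction y with
        | zero => simp
        | add y y' hy hy' => rw [map_add, lie_add, lie_add, hy, hy']
        | tmul t y => simp [hJab])
    τ
    (fun x y ↦ by
      induction x with
      | zero => simp
      | add x x' hx hx' => rw [map_add, map_add, LinearMap.add_apply, hx, hx', neg_add]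
      | tmul s x =>
        induction y with
        | zero => simp
        | add y y' hy hy' => rw [map_add, map_add, LinearMap.add_apply, hy, hy', neg_add]
        | tmul t y =>
          rw [τ_tmul, τ_tmul, skew x y]
          push_cast
          ring)
    (fun x y z ↦ by
      induction x with
      | zero => simp
      | add x x' hx hx' =>
        simp only [add_lie, lie_add, map_add, LinearMap.add_apply]
        linear_combination hx + hx'
      | tmul s x =>
        induction y with
        | zero => simp
        | add y y' hy hy' =>
          simp only [add_lie, lie_add, map_add, LinearMap.add_apply]
          linear_combination hy + hy'
        | tmul t y =>
          induction z with
          | zero => simp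
          | add z z' hz hz' =>
            simp only [add_lie, lie_add, map_add, LinearMap.add_apply]
            linear_combination hz + hz'
          | tmul r z =>
            simp only [LieAlgebra.ExtendScalars.bracket_tmul, τ_tmul]
            have h : ((σ ⁅x, y⁆ z : ℝ) : ℂ) + (σ ⁅y, z⁆ x : ℝ) + (σ ⁅z, x⁆ y : ℝ) = 0 := by
              exact_mod_cast hcocycle x y z
            linear_combination s * t * r * h)
    (fun x y ↦ by
      induction x with
      | zero => simp
      | add x x' hx hx' => simp only [map_add, LinearMap.add_apply, hx, hx']
      | tmul s x =>
        induction y with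
        | zero => simp
        | add y y' hy hy' => simp only [map_add, hy, hy']
        | tmul t y => simp only [LinearMap.baseChange_tmul, τ_tmul, hJinv])
    (1 ⊗ₜ a) (1 ⊗ₜ b) (1 ⊗ₜ c) (1 ⊗ₜ d)
  simpa only [LieAlgebra.ExtendScalars.bracket_tmul, τ_tmul, mul_one, one_mul,
    Complex.ofReal_eq_zero] using h

/-- if `J` is an abelian complex structure on a finite-dimensional real Lie
algebra `𝔥` and `σ` is a `J`-invariant 2-cocycle, then `σ` vanishes on the commutator
ideal `[𝔥, 𝔥]`; in particular `σ([a,b],[c,d]) = 0` for all `a, b, c, d`. -/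
theorem cocycle_vanishes_on_commutator
    {L : Type*} [LieRing L] [LieAlgebra ℝ L] [FiniteDimensional ℝ L]
    (J : L →ₗ[ℝ] L)
    (hJ2 : ∀ x : L, J (J x) = -x)
    (hJab : ∀ x y : L, ⁅J x, J y⁆ = ⁅x, y⁆)
    (σ : L →ₗ[ℝ] L →ₗ[ℝ] ℝ)
    (halt : ∀ x : L, σ x x = 0)
    (hcocycle : ∀ x y z : L, σ ⁅x, y⁆ z + σ ⁅y, z⁆ x + σ ⁅z, x⁆ y = 0)
    (hJinv : ∀ x y : L, σ (J x) (J y) = σ x y) :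
    (∀ x y : L, x ∈ LieAlgebra.derivedSeries ℝ L 1 → y ∈ LieAlgebra.derivedSeries ℝ L 1 →
        σ x y = 0)
    ∧ (∀ a b c d : L, σ ⁅a, b⁆ ⁅c, d⁆ = 0) := by
  have key := cocycle_lie_lie_eq_zero J hJ2 hJab σ halt hcocycle hJinv
  refine ⟨fun x y hx hy ↦ ?_, key⟩
  have mem : (LieAlgebra.derivedSeries ℝ L 1).toSubmodule =
      Submodule.span ℝ {w : L | ∃ u v : L, ⁅u, v⁆ = w} := by
    rw [LieAlgebra.derivedSeries_def, LieAlgebra.derivedSeriesOfIdeal_succ,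
      LieAlgebra.derivedSeriesOfIdeal_zero, LieSubmodule.lieIdeal_oper_eq_linear_span']
    simp
  rw [← LieSubmodule.mem_toSubmodule, mem] at hx hy
  induction hx, hy using Submodule.span_induction₂ with
  | mem_mem x y hx hy =>
    obtain ⟨a, b, rfl⟩ := hx
    obtain ⟨c, d, rfl⟩ := hy
    exact key a b c d
  | zero_left => simp
  | zero_right => simp
  | add_left _ _ _ _ _ _ h₁ h₂ => simp [h₁, h₂]
  | add_right _ _ _ _ _ _ h₁ h₂ => simp [h₁, h₂]
  | smul_left _ _ _ _ _ h => simp [h]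
  | smul_right _ _ _ _ _ h => simp [h]
end

section
/- Let (φ, ξ, η) be an abelian almost contact structure on a finite-dimensional real Lie algebra 𝔤 such that 𝔥 := ker η is a Lie subalgebra of 𝔤. Then: (a) [ξ, X] ∈ 𝔥 for every X ∈ 𝔥; (b) D := ad_ξ restricted to 𝔥 is a derivation of 𝔥 (D([X,Y]) = [D(X), Y] + [X, D(Y)] for X, Y ∈ 𝔥) which commutes with J := φ restricted to 𝔥; (c) J is an abelian complex structure on 𝔥, i.e. J(J(X)) = −X and [J(X), J(Y)] = [X, Y] for all X, Y ∈ 𝔥. -/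
/-- In an almost contact structure, `φ ξ = 0`. -/
theorem almostContact_map_xi {L : Type*} [AddCommGroup L] [Module ℝ L]
    (φ : L →ₗ[ℝ] L) (ξ : L) (η : L →ₗ[ℝ] ℝ)
    (hφ : ∀ x : L, φ (φ x) = -x + η x • ξ) (hη : η ξ = 1) : φ ξ = 0 := by
  have h0 : φ (φ ξ) = 0 := by simp [hφ, hη]
  have h1 : φ ξ = η (φ ξ) • ξ := by
    have h := hφ (φ ξ)
    rw [h0, map_zero] at h
    exact (neg_add_eq_zero.mp h.symm)
  have h2 : η (φ ξ) * η (φ ξ) = 0 := by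
    have h := congrArg η h0
    rw [h1, map_smul, map_smul, map_zero, smul_eq_mul] at h
    simpa [hη] using h
  rw [h1, mul_self_eq_zero.mp h2, zero_smul]

/-- In an almost contact structure, `η ∘ φ = 0`. -/
theorem almostContact_eta_map {L : Type*} [AddCommGroup L] [Module ℝ L]
    (φ : L →ₗ[ℝ] L) (ξ : L) (η : L →ₗ[ℝ] ℝ)
    (hφ : ∀ x : L, φ (φ x) = -x + η x • ξ) (hη : η ξ = 1) (x : L) : η (φ x) = 0 := by
  have h := hφ (φ x)
  rw [hφ x, map_add, map_neg, map_smul, almostContact_map_xi φ ξ η hφ hη, smul_zero] at h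
  have h' := congrArg η (add_left_cancel h)
  simpa [hη] using h'.symm

/-- if `(φ, ξ, η)` is an abelian almost contact structure on a
finite-dimensional real Lie algebra `𝔤` with `𝔥 = ker η` a subalgebra, then `𝔥` is
`ad_ξ`-invariant, `D = ad_ξ|_𝔥` is a derivation of `𝔥` commuting with `J = φ|_𝔥`, and
`J` is an abelian complex structure on `𝔥`. -/
theorem semidirect_product_structure
    {L : Type*} [LieRing L] [LieAlgebra ℝ L] [FiniteDimensional ℝ L]
    (φ : L →ₗ[ℝ] L) (ξ : L) (η : L →ₗ[ℝ] ℝ)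
    (hφ : ∀ x : L, φ (φ x) = -x + η x • ξ) (hη : η ξ = 1)
    (hab₁ : ∀ x : L, ⁅ξ, φ x⁆ = φ ⁅ξ, x⁆)
    (hab₂ : ∀ X Y : L, η X = 0 → η Y = 0 → ⁅φ X, φ Y⁆ = ⁅X, Y⁆)
    (hsub : ∀ X Y : L, η X = 0 → η Y = 0 → η ⁅X, Y⁆ = 0) :
    -- (a) `𝔥` is `ad_ξ`-invariant
    ((∀ X : L, η X = 0 → η ⁅ξ, X⁆ = 0) ∧
      -- (b) `D = ad_ξ|_𝔥` is a derivation of `𝔥` commuting with `J = φ|_𝔥`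
      (∀ X Y : L, η X = 0 → η Y = 0 →
        ⁅ξ, (⁅X, Y⁆ : L)⁆ = ⁅(⁅ξ, X⁆ : L), Y⁆ + ⁅X, (⁅ξ, Y⁆ : L)⁆) ∧
      (∀ X : L, η X = 0 → ⁅ξ, φ X⁆ = φ ⁅ξ, X⁆) ∧
      -- (c) `J` is an abelian complex structure on `𝔥`
      (∀ X : L, η X = 0 → η (φ X) = 0) ∧
      (∀ X : L, η X = 0 → φ (φ X) = -X) ∧
      (∀ X Y : L, η X = 0 → η Y = 0 → ⁅φ X, φ Y⁆ = ⁅X, Y⁆)) := by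
  have hηφ := almostContact_eta_map φ ξ η hφ hη
  have hJ : ∀ X : L, η X = 0 → φ (φ X) = -X := fun X hX => by simp [hφ, hX]
  refine ⟨fun X hX => ?_, fun X Y _ _ => leibniz_lie ξ X Y, fun X _ => hab₁ X,
    fun X _ => hηφ X, hJ, hab₂⟩
  have h := hηφ ⁅ξ, φ X⁆
  rwa [← hab₁, hJ X hX, lie_neg, map_neg, neg_eq_zero] at h
end

section
/- Let (𝔤, φ, ξ, η, g) be an almost contact metric Lie algebra with abelian structure and let α ∈ ℝ. Then dη = 0 and dΦ = 2α·(η∧Φ) hold if and only if both of the following hold: (1) 𝔥 := ker η is a Lie subalgebra of 𝔤 and the 2-form ω on 𝔥 given by ω(X,Y) := g(X, φ(Y)) is closed, i.e. ω([X,Y], Z) + ω([Y,Z], X) + ω([Z,X], Y) = 0 for all X, Y, Z ∈ 𝔥; (2) the symmetric part of ad_ξ on 𝔥 equals −α·id, i.e. g([ξ,X], Y) + g(X, [ξ,Y]) = −2α·g(X,Y) for all X, Y ∈ 𝔥. -/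
/-- characterization of `α`-coKähler abelian almost contact metric Lie
algebras.  Here `Φ X Y = g X (φ Y)`, `dη(X,Y) = −η [X,Y]` and
`dΦ(X,Y,Z) = −Φ([X,Y],Z) − Φ([Y,Z],X) − Φ([Z,X],Y)`. -/
theorem alpha_coKahler_characterization
    {L : Type*} [LieRing L] [LieAlgebra ℝ L] [FiniteDimensional ℝ L]
    (φ : L →ₗ[ℝ] L) (ξ : L) (η : L →ₗ[ℝ] ℝ) (g : L →ₗ[ℝ] L →ₗ[ℝ] ℝ) (α : ℝ)
    (hφ : ∀ x : L, φ (φ x) = -x + η x • ξ) (hη : η ξ = 1)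
    (hgsymm : ∀ x y : L, g x y = g y x)
    (hgpos : ∀ x : L, x ≠ 0 → 0 < g x x)
    (hcompat : ∀ X Y : L, g (φ X) (φ Y) = g X Y - η X * η Y)
    (hab₁ : ∀ x : L, ⁅ξ, φ x⁆ = φ ⁅ξ, x⁆)
    (hab₂ : ∀ X Y : L, η X = 0 → η Y = 0 → ⁅φ X, φ Y⁆ = ⁅X, Y⁆) :
    -- dη = 0 and dΦ = 2α·(η ∧ Φ)
    ((∀ X Y : L, -η ⁅X, Y⁆ = 0) ∧
      (∀ X Y Z : L,
        -g ⁅X, Y⁆ (φ Z) - g ⁅Y, Z⁆ (φ X) - g ⁅Z, X⁆ (φ Y) =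
          2 * α * (η X * g Y (φ Z) + η Y * g Z (φ X) + η Z * g X (φ Y))))
    ↔
    -- (1) `𝔥 = ker η` is a subalgebra and `ω = Φ|_𝔥` is closed
    (((∀ X Y : L, η X = 0 → η Y = 0 → η ⁅X, Y⁆ = 0) ∧
        (∀ X Y Z : L, η X = 0 → η Y = 0 → η Z = 0 →
          g ⁅X, Y⁆ (φ Z) + g ⁅Y, Z⁆ (φ X) + g ⁅Z, X⁆ (φ Y) = 0)) ∧
      -- (2) the symmetric part of `ad_ξ|_𝔥` equals `−α·id`
      (∀ X Y : L, η X = 0 → η Y = 0 →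
        g ⁅ξ, X⁆ Y + g X ⁅ξ, Y⁆ = -(2 * α) * g X Y)) := by
  have φξ : φ ξ = 0 := by
    have h0 : φ (φ ξ) = 0 := by simp [hφ, hη]
    have h1 : φ ξ = η (φ ξ) • ξ := by
      have h := hφ (φ ξ)
      rw [h0, map_zero] at h
      exact (neg_add_eq_zero.mp h.symm)
    have h2 : η (φ ξ) * η (φ ξ) = 0 := by
      have h := congrArg (fun x => η (φ x)) h1
      simpa [h0] using h.symm
    rw [h1, mul_self_eq_zero.mp h2, zero_smul]
  have ηφ : ∀ x, η (φ x) = 0 := by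
    intro x
    have h := hφ (φ x)
    rw [hφ x, map_add, map_neg, map_smul, φξ, smul_zero, add_zero, left_eq_add] at h
    simpa [hη] using congrArg η h
  have gξ : ∀ x, g ξ x = η x := by
    intro x
    have h := hcompat ξ x
    simp only [φξ, map_zero, LinearMap.zero_apply, hη] at h
    linarith
  have ηad : ∀ x, η x = 0 → η ⁅ξ, x⁆ = 0 := by
    intro x hx
    have h := congrArg η (hab₁ (φ x))
    rw [ηφ, hφ, hx, zero_smul, add_zero, lie_neg, map_neg] at h
    linarith
  have swap : ∀ Y Z, η Y = 0 → g ⁅ξ, Z⁆ (φ Y) = -g Y ⁅ξ, φ Z⁆ := by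
    intro Y Z hY
    have h := hcompat ⁅ξ, Z⁆ (φ Y)
    rw [ηφ, hφ, hY, zero_smul, add_zero, ← hab₁, map_neg, hgsymm] at h
    linarith
  constructor
  · rintro ⟨hdη, hdΦ⟩
    refine ⟨⟨fun X Y _ _ => neg_eq_zero.mp (hdη X Y), fun X Y Z hX hY hZ => ?_⟩,
      fun X Y hX hY => ?_⟩
    · have h := hdΦ X Y Z
      rw [hX, hY, hZ] at h
      linarith
    · have h := hdΦ ξ X (φ Y)
      rw [← lie_skew (φ Y) ξ, φξ, hφ, hη, hX, hY, ηφ] at h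
      have hs := swap X (φ Y) hX
      rw [hφ, hY] at hs
      simp only [zero_smul, add_zero, lie_neg, map_neg, map_zero, LinearMap.neg_apply] at h hs
      linarith
  · rintro ⟨⟨hsub, hω⟩, hsymm⟩
    have key : ∀ Y Z, η Y = 0 →
        -g ⁅ξ, Y⁆ (φ Z) + g ⁅ξ, Z⁆ (φ Y) = 2 * α * g Y (φ Z) := by
      intro Y Z hY
      have h := hsymm Y (φ Z) hY (ηφ Z)
      rw [swap Y Z hY]
      linarith
    have decomp : ∀ X, ∃ X', η X' = 0 ∧ X = X' + η X • ξ := fun X =>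
      ⟨X - η X • ξ, by simp [hη], by simp⟩
    refine ⟨fun X Y => ?_, fun X Y Z => ?_⟩
    · obtain ⟨X', hX, eX⟩ := decomp X
      obtain ⟨Y', hY, eY⟩ := decomp Y
      rw [eX, eY, add_lie, lie_add, lie_add, ← lie_skew X' (η Y • ξ)]
      simp [hsub X' Y' hX hY, ηad X' hX, ηad Y' hY]
    · obtain ⟨X', hX, eX⟩ := decomp X
      obtain ⟨Y', hY, eY⟩ := decomp Y
      obtain ⟨Z', hZ, eZ⟩ := decomp Z
      generalize η X = a at *
      generalize η Y = b at *
      generalize η Z = c at *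
      subst eX eY eZ
      have h := hω X' Y' Z' hX hY hZ
      have h1 := key Y' Z' hY
      have h2 := key Z' X' hZ
      have h3 := key X' Y' hX
      have e : ∀ (U V : L) (s t : ℝ),
          ⁅U + s • ξ, V + t • ξ⁆ = ⁅U, V⁆ + s • ⁅ξ, V⁆ - t • ⁅ξ, U⁆ := by
        intro U V s t
        rw [add_lie, lie_add, lie_add, ← lie_skew U (t • ξ)]
        simp only [smul_lie, lie_smul, lie_self, smul_zero]
        abel
      simp only [e, map_add, map_sub, map_smul, φξ, smul_zero, add_zero, LinearMap.add_apply,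
        LinearMap.sub_apply, LinearMap.smul_apply, smul_eq_mul, gξ, ηφ, mul_zero]
      linear_combination -h + a * h1 + b * h2 + c * h3
end

section
/- Let (φ_i, ξ_i, η_i), i = 1,2,3, be an abelian almost 3-contact structure on a finite-dimensional real Lie algebra 𝔤, and for each even permutation (i,j,k) of (1,2,3) set ζ_k := [ξ_i, ξ_j]. Then, for every even permutation (i,j,k) of (1,2,3): (1) φ_i(ζ_j) = ζ_k = −φ_j(ζ_i) and φ_i(ζ_i) = φ_j(ζ_j); (2) η_i(ζ_k) = 0, η_j(ζ_k) = 0, and η_i(ζ_i) = η_j(ζ_j). -/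
/-- `(i,j,k)` is an even permutation of `(1,2,3)` (indexed here as `(0,1,2)`). -/
def evenPerm (i j k : Fin 3) : Prop :=
  (i, j, k) = ((0 : Fin 3), (1 : Fin 3), (2 : Fin 3)) ∨
  (i, j, k) = ((1 : Fin 3), (2 : Fin 3), (0 : Fin 3)) ∨
  (i, j, k) = ((2 : Fin 3), (0 : Fin 3), (1 : Fin 3))

/-- An abelian almost 3-contact structure on a real Lie algebra `L`: three almost
contact structures `(φ i, ξ i, η i)` satisfying the quaternionic-like compatibility
relations for every even permutation `(i,j,k)` of `(1,2,3)`, each of which is abelian. -/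
structure AbelianAC3 (L : Type*) [LieRing L] [LieAlgebra ℝ L] where
  φ : Fin 3 → (L →ₗ[ℝ] L)
  ξ : Fin 3 → L
  η : Fin 3 → (L →ₗ[ℝ] ℝ)
  acs : ∀ i, ∀ x : L, φ i (φ i x) = -x + η i x • ξ i
  unit : ∀ i, η i (ξ i) = 1
  comp_phi : ∀ i j k, evenPerm i j k → ∀ x : L, φ k x = φ i (φ j x) - η j x • ξ i
  comp_phi' : ∀ i j k, evenPerm i j k → ∀ x : L, φ k x = -φ j (φ i x) + η i x • ξ j
  comp_xi : ∀ i j k, evenPerm i j k → φ i (ξ j) = ξ k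
  comp_xi' : ∀ i j k, evenPerm i j k → φ j (ξ i) = -ξ k
  comp_eta : ∀ i j k, evenPerm i j k → ∀ x : L, η i (φ j x) = η k x
  comp_eta' : ∀ i j k, evenPerm i j k → ∀ x : L, η j (φ i x) = -η k x
  abelian_ad : ∀ i, ∀ x : L, ⁅ξ i, φ i x⁆ = φ i ⁅ξ i, x⁆
  abelian_br : ∀ i, ∀ X Y : L, η i X = 0 → η i Y = 0 → ⁅φ i X, φ i Y⁆ = ⁅X, Y⁆

namespace AbelianAC3

variable {L : Type*} [LieRing L] [LieAlgebra ℝ L]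

/-- Membership in the horizontal subspace `𝔥 = ⋂ ker (η i)`. -/
def inH (S : AbelianAC3 L) (x : L) : Prop := ∀ i, S.η i x = 0

/-- The horizontal subspace `𝔥` as a submodule. -/
def H (S : AbelianAC3 L) : Submodule ℝ L :=
  LinearMap.ker (S.η 0) ⊓ LinearMap.ker (S.η 1) ⊓ LinearMap.ker (S.η 2)

/-- The vertical subspace `𝔳 = span{ξ₁, ξ₂, ξ₃}`. -/
def V (S : AbelianAC3 L) : Submodule ℝ L :=
  Submodule.span ℝ {S.ξ 0, S.ξ 1, S.ξ 2}

/-- The endomorphism `ψ(X) = [ξ₁, φ₁ X]` (as a linear map on all of `L`). -/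
def psi (S : AbelianAC3 L) : L →ₗ[ℝ] L :=
  (LieAlgebra.ad ℝ L (S.ξ 0)) ∘ₗ (S.φ 0)

/-- The distinguished horizontal vector `𝒵 = φ₁([ξ₂, ξ₃])`. -/
def Z (S : AbelianAC3 L) : L := S.φ 0 ⁅S.ξ 1, S.ξ 2⁆

end AbelianAC3

theorem evenPerm.rotate {i j k : Fin 3} (h : evenPerm i j k) : evenPerm j k i := by
  simp only [evenPerm, Prod.mk.injEq] at h ⊢
  tauto

namespace AbelianAC3

variable {L : Type*} [LieRing L] [LieAlgebra ℝ L] (S : AbelianAC3 L)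

/-- The Reeb vector lies in the kernel of its endomorphism. -/
theorem phi_xi_self (i : Fin 3) : S.φ i (S.ξ i) = 0 := by
  have hsq : S.φ i (S.φ i (S.ξ i)) = 0 := by
    rw [S.acs, S.unit, one_smul, neg_add_cancel]
  have hmul : S.φ i (S.ξ i) = S.η i (S.φ i (S.ξ i)) • S.ξ i := by
    have h := S.acs i (S.φ i (S.ξ i))
    rw [hsq, map_zero] at h
    exact (neg_add_eq_zero.mp h.symm)
  have hc : S.η i (S.φ i (S.ξ i)) = 0 := by
    have h := congrArg (fun x => S.η i (S.φ i x)) hmul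
    simpa only [hsq, map_zero, map_smul, smul_eq_mul, zero_eq_mul, or_self] using h
  rw [hmul, hc, zero_smul]

theorem eta_phi_self (i : Fin 3) (x : L) : S.η i (S.φ i x) = 0 := by
  have h := S.acs i (S.φ i x)
  rw [S.acs i x, map_add, map_neg, map_smul, phi_xi_self, smul_zero, add_zero,
    left_eq_add] at h
  simpa [S.unit] using congrArg (S.η i) h

theorem phi_lie_xi {i j k : Fin 3} (h : evenPerm i j k) :
    S.φ i ⁅S.ξ k, S.ξ i⁆ = ⁅S.ξ i, S.ξ j⁆ := by
  rw [← lie_skew, map_neg, ← S.abelian_ad, S.comp_xi' k i j h.rotate.rotate, lie_neg, neg_neg]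

theorem phi_lie_xi' {i j k : Fin 3} (h : evenPerm i j k) :
    S.φ j ⁅S.ξ j, S.ξ k⁆ = -⁅S.ξ i, S.ξ j⁆ := by
  rw [← S.abelian_ad, S.comp_xi j k i h.rotate, lie_skew]

end AbelianAC3


/-- properties of the vectors `ζ_k := [ξ_i, ξ_j]` for an abelian almost
3-contact structure. -/
theorem AbelianAC3.zeta_properties
    {L : Type*} [LieRing L] [LieAlgebra ℝ L] [FiniteDimensional ℝ L]
    (S : AbelianAC3 L) (ζ : Fin 3 → L)
    (hζ : ∀ i j k, evenPerm i j k → ζ k = ⁅S.ξ i, S.ξ j⁆) :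
    ∀ i j k, evenPerm i j k →
      (S.φ i (ζ j) = ζ k ∧ S.φ j (ζ i) = -ζ k ∧ S.φ i (ζ i) = S.φ j (ζ j) ∧
        S.η i (ζ k) = 0 ∧ S.η j (ζ k) = 0 ∧ S.η i (ζ i) = S.η j (ζ j)) := by
  have phi_next : ∀ {i j k}, evenPerm i j k → S.φ i (ζ j) = ζ k := fun {i j k} h => by
    rw [hζ k i j h.rotate.rotate, hζ i j k h, S.phi_lie_xi h]
  have phi_prev : ∀ {i j k}, evenPerm i j k → S.φ j (ζ i) = -ζ k := fun {i j k} h => by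
    rw [hζ j k i h.rotate, hζ i j k h, S.phi_lie_xi' h]
  have eta_first : ∀ {i j k}, evenPerm i j k → S.η i (ζ k) = 0 := fun {i j k} h => by
    rw [← phi_next h, S.eta_phi_self]
  have eta_second : ∀ {i j k}, evenPerm i j k → S.η j (ζ k) = 0 := fun {i j k} h => by
    rw [← neg_eq_zero, ← map_neg, ← phi_prev h, S.eta_phi_self]
  intro i j k h
  have hj : S.φ k (ζ i) = ζ j := phi_next h.rotate.rotate
  refine ⟨phi_next h, phi_prev h, ?_, eta_first h, eta_second h, ?_⟩
  · rw [S.comp_phi j k i h.rotate, hj, eta_second h.rotate, zero_smul, sub_zero]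
  · rw [← S.comp_eta j k i h.rotate, hj]
end

section
/- Let (φ_i, ξ_i, η_i), i = 1,2,3, be an abelian almost 3-contact structure on a finite-dimensional real Lie algebra 𝔤. Then, for every even permutation (i,j,k) of (1,2,3) and all X, Y ∈ 𝔥: (1) [ξ_i, φ_i(X)] = [ξ_j, φ_j(X)]; (2) [ξ_i, φ_j(X)] = −[ξ_j, φ_i(X)] = [ξ_k, X] = φ_i([ξ_j, X]) = −φ_j([ξ_i, X]); (3) [ξ_i, X] ∈ 𝔥; (4) [φ_i(X), φ_j(Y)] = [φ_k(X), Y] = −[φ_j(X), φ_i(Y)]. -/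
theorem evenPerm.eq_or_eq_or_eq {i j k : Fin 3} (h : evenPerm i j k) (l : Fin 3) :
    l = i ∨ l = j ∨ l = k := by
  revert i j k l
  unfold evenPerm
  decide

namespace AbelianAC3

variable {L : Type*} [LieRing L] [LieAlgebra ℝ L] (S : AbelianAC3 L)

variable {S} {i j k : Fin 3} {X Y : L}

theorem eta_xi_next (h : evenPerm i j k) : S.η i (S.ξ j) = 0 := by
  rw [← neg_eq_zero, ← S.comp_eta' _ _ _ h.rotate, phi_xi_self, map_zero]

theorem eta_xi_prev (h : evenPerm i j k) : S.η i (S.ξ k) = 0 := by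
  rw [← S.comp_eta _ _ _ h.rotate, phi_xi_self, map_zero]

theorem inH.phi (hX : S.inH X) (h : evenPerm i j k) : S.inH (S.φ i X) := by
  intro l
  rcases h.eq_or_eq_or_eq l with rfl | rfl | rfl
  · exact S.eta_phi_self _ _
  · rw [S.comp_eta' _ _ _ h, hX, neg_zero]
  · rw [S.comp_eta _ _ _ h.rotate.rotate, hX]

theorem inH.phi_phi_self (hX : S.inH X) (i : Fin 3) : S.φ i (S.φ i X) = -X := by
  rw [S.acs, hX, zero_smul, add_zero]

theorem inH.phi_phi (hX : S.inH X) (h : evenPerm i j k) : S.φ i (S.φ j X) = S.φ k X := by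
  rw [S.comp_phi _ _ _ h, hX, zero_smul, sub_zero]

theorem inH.phi_phi_swap (hX : S.inH X) (h : evenPerm i j k) :
    S.φ j (S.φ i X) = -S.φ k X := by
  rw [S.comp_phi' _ _ _ h, hX, zero_smul, add_zero, neg_neg]

theorem bracket_xi_prev_phi (h : evenPerm i j k) (hX : S.inH X) :
    ⁅S.ξ k, S.φ i X⁆ = ⁅S.ξ j, X⁆ := by
  rw [← S.abelian_br i _ _ (eta_xi_next h) (hX i), S.comp_xi _ _ _ h]

theorem bracket_xi_next_phi (h : evenPerm i j k) (hX : S.inH X) :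
    ⁅S.ξ j, S.φ i X⁆ = -⁅S.ξ k, X⁆ := by
  rw [← S.abelian_br i _ _ (eta_xi_prev h) (hX i), S.comp_xi' _ _ _ h.rotate.rotate,
    neg_lie, neg_neg]

theorem eta_bracket_xi_self (hX : S.inH X) (i : Fin 3) : S.η i ⁅S.ξ i, X⁆ = 0 := by
  have h : S.φ i ⁅S.ξ i, S.φ i X⁆ = -⁅S.ξ i, X⁆ := by
    rw [← S.abelian_ad, hX.phi_phi_self, lie_neg]
  rw [← neg_eq_zero, ← map_neg, ← h, eta_phi_self]

theorem inH_bracket_xi (h : evenPerm i j k) (hX : S.inH X) : S.inH ⁅S.ξ i, X⁆ := by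
  intro l
  rcases h.eq_or_eq_or_eq l with rfl | rfl | rfl
  · exact eta_bracket_xi_self hX _
  · rw [← bracket_xi_prev_phi h.rotate.rotate hX]
    exact eta_bracket_xi_self (hX.phi h.rotate.rotate) _
  · rw [← neg_eq_zero, ← map_neg, ← bracket_xi_next_phi h.rotate hX]
    exact eta_bracket_xi_self (hX.phi h.rotate) _

theorem bracket_xi_phi_eq (h : evenPerm i j k) (hX : S.inH X) :
    ⁅S.ξ i, S.φ i X⁆ = ⁅S.ξ j, S.φ j X⁆ := by
  rw [← bracket_xi_prev_phi h.rotate.rotate (hX.phi h), hX.phi_phi h.rotate.rotate]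

theorem phi_bracket_xi_next (h : evenPerm i j k) (hX : S.inH X) :
    S.φ i ⁅S.ξ j, X⁆ = ⁅S.ξ k, X⁆ := by
  rw [← neg_neg ⁅S.ξ j, X⁆, ← bracket_xi_next_phi h.rotate.rotate hX, map_neg,
    ← S.abelian_ad, hX.phi_phi_swap h.rotate.rotate, lie_neg, neg_neg,
    bracket_xi_prev_phi h.rotate hX]

theorem phi_bracket_xi_prev (h : evenPerm i j k) (hX : S.inH X) :
    S.φ j ⁅S.ξ i, X⁆ = -⁅S.ξ k, X⁆ := by
  rw [← bracket_xi_prev_phi h.rotate.rotate hX, ← S.abelian_ad, hX.phi_phi h.rotate,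
    bracket_xi_next_phi h hX]

theorem bracket_phi_phi_swap (h : evenPerm i j k) (hX : S.inH X) (hY : S.inH Y) :
    ⁅S.φ i X, S.φ j Y⁆ = -⁅S.φ j X, S.φ i Y⁆ := by
  rw [← S.abelian_br k _ _ (hX.phi h k) (hY.phi h.rotate k), hX.phi_phi h.rotate.rotate,
    hY.phi_phi_swap h.rotate, lie_neg]

theorem bracket_phi_phi (h : evenPerm i j k) (hX : S.inH X) (hY : S.inH Y) :
    ⁅S.φ i X, S.φ j Y⁆ = ⁅S.φ k X, Y⁆ := by
  rw [← S.abelian_br i _ _ (hX.phi h i) (hY.phi h.rotate i), hX.phi_phi_self,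
    hY.phi_phi h, ← S.abelian_br k _ _ (hX.phi h.rotate.rotate k) (hY k), hX.phi_phi_self]

end AbelianAC3

/-- bracket identities for an abelian almost 3-contact structure. -/
theorem AbelianAC3.bracket_identities
    {L : Type*} [LieRing L] [LieAlgebra ℝ L] [FiniteDimensional ℝ L]
    (S : AbelianAC3 L) :
    ∀ i j k, evenPerm i j k → ∀ X Y : L, S.inH X → S.inH Y →
      (⁅S.ξ i, S.φ i X⁆ = ⁅S.ξ j, S.φ j X⁆ ∧
        (⁅S.ξ i, S.φ j X⁆ = -⁅S.ξ j, S.φ i X⁆ ∧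
          ⁅S.ξ i, S.φ j X⁆ = ⁅S.ξ k, X⁆ ∧
          ⁅S.ξ i, S.φ j X⁆ = S.φ i ⁅S.ξ j, X⁆ ∧
          ⁅S.ξ i, S.φ j X⁆ = -S.φ j ⁅S.ξ i, X⁆) ∧
        S.inH ⁅S.ξ i, X⁆ ∧
        (⁅S.φ i X, S.φ j Y⁆ = ⁅S.φ k X, Y⁆ ∧
          ⁅S.φ i X, S.φ j Y⁆ = -⁅S.φ j X, S.φ i Y⁆)) := by
  intro i j k h X Y hX hY
  have hij : ⁅S.ξ i, S.φ j X⁆ = ⁅S.ξ k, X⁆ := bracket_xi_prev_phi h.rotate hX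
  refine ⟨bracket_xi_phi_eq h hX, ⟨?_, hij, ?_, ?_⟩, inH_bracket_xi h hX,
    bracket_phi_phi h hX hY, bracket_phi_phi_swap h hX hY⟩
  · rw [hij, bracket_xi_next_phi h hX, neg_neg]
  · rw [hij, phi_bracket_xi_next h hX]
  · rw [hij, phi_bracket_xi_prev h hX, neg_neg]
end
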